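/- Let w > 0, k > 0 and M be reals with M ≥ k + 2w. Let H be the gadget graph with vertices u, u₁, u₂, u₃, u₄ and ũ, ũ₁, ũ₂, ũ₃, ũ₄, edges {u,u₁}, {u₁,u₂}, {u₂,u₃}, {u₂,u₄}, {u₃,u₄} together with {u,ũ}, {u₁,ũ₁}, {u₂,ũ₂}, {u₃,ũ₃}, {u₄,ũ₄}, and vertex weights w_u = w, w_{u₁} = w_{u₄} = M − w, w_{u₂} = w_{u₃} = k + w, and weight M + k + 1 on each of ũ, ũ₁, ũ₂, ũ₃, ũ₄. Then in every orientation Λ of H with weighted star value x(H,Λ) ≤ M + k, the edge {u,ũ} is directed toward ũ and the edge {u,u₁} is directed toward u. -/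

import Mathlib

open Finset

/-- An orientation of a simple graph `G`: `dir u v = true` means the edge `{u,v}`
is directed from `u` (tail) to `v` (head), i.e. the edge receives color `u`. -/
structure GraphOrientation {V : Type*} (G : SimpleGraph V) where
  dir : V → V → Bool
  adj_of_dir : ∀ u v, dir u v = true → G.Adj u v
  dir_iff : ∀ u v, G.Adj u v → (dir u v = true ↔ dir v u = false)

variable {V : Type*} [Fintype V]

/-- The indegree of `v` under an orientation. -/
def GraphOrientation.indeg {G : SimpleGraph V} (Λ : GraphOrientation G) (v : V) : ℕ :=
  (univ.filter fun u => Λ.dir u v = true).card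

/-- The outdegree of `v` under an orientation. -/
def GraphOrientation.outdeg {G : SimpleGraph V} (Λ : GraphOrientation G) (v : V) : ℕ :=
  (univ.filter fun u => Λ.dir v u = true).card

/-- The star value `x(G,Λ,v) = δ⁻(v) + (1 if δ⁺(v) > 0 else 0)`. -/
def GraphOrientation.starVal {G : SimpleGraph V} (Λ : GraphOrientation G) (v : V) : ℕ :=
  Λ.indeg v + (if 0 < Λ.outdeg v then 1 else 0)

/-- `x(G,Λ) = max over vertices of the star value`. -/
def GraphOrientation.starMax {G : SimpleGraph V} (Λ : GraphOrientation G) : ℕ :=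
  univ.sup fun v => Λ.starVal v

/-- The min-max star partitioning number `x*(G)` (no capacity constraints). -/
noncomputable def xStar (G : SimpleGraph V) : ℕ :=
  sInf {n | ∃ Λ : GraphOrientation G, Λ.starMax = n}

/-- The weighted indegree `k(G,Λ,v)`: the sum of the weights of the tails of the
edges directed toward `v`. -/
def GraphOrientation.wIndeg {G : SimpleGraph V} (Λ : GraphOrientation G)
    (w : V → ℝ) (v : V) : ℝ :=
  ∑ u ∈ univ.filter (fun u => Λ.dir u v = true), w u

/-- The weighted star value `x(G,Λ,v) = k(G,Λ,v) + (w_v if v has an outgoing edge)`. -/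
def GraphOrientation.wStarVal {G : SimpleGraph V} (Λ : GraphOrientation G)
    (w : V → ℝ) (v : V) : ℝ :=
  Λ.wIndeg w v + (if 0 < Λ.outdeg v then w v else 0)

/-- `k(G,Λ) = max over vertices of the weighted indegree`. -/
noncomputable def GraphOrientation.wIndegMax [Nonempty V] {G : SimpleGraph V}
    (Λ : GraphOrientation G) (w : V → ℝ) : ℝ :=
  univ.sup' univ_nonempty (Λ.wIndeg w)

/-- `x(G,Λ) = max over vertices of the weighted star value`. -/
noncomputable def GraphOrientation.wStarMax [Nonempty V] {G : SimpleGraph V}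
    (Λ : GraphOrientation G) (w : V → ℝ) : ℝ :=
  univ.sup' univ_nonempty (Λ.wStarVal w)

/-- The gadget edges among `u = 0, u₁ = 1, u₂ = 2, u₃ = 3, u₄ = 4`:
`{u,u₁}, {u₁,u₂}, {u₂,u₃}, {u₂,u₄}, {u₃,u₄}`. -/
def gadgetPair (i j : Fin 5) : Prop :=
  (i = 0 ∧ j = 1) ∨ (i = 1 ∧ j = 2) ∨ (i = 2 ∧ j = 3) ∨ (i = 2 ∧ j = 4) ∨ (i = 3 ∧ j = 4)

/-- The gadget graph `G_u` on the vertices `u, u₁, u₂, u₃, u₄` (encoded as `Sum.inl i`)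
and `ũ, ũ₁, ũ₂, ũ₃, ũ₄` (encoded as `Sum.inr i`), with the five gadget edges together
with the pendant edges `{u_i, ũ_i}`. -/
def gadgetGraph : SimpleGraph (Fin 5 ⊕ Fin 5) :=
  SimpleGraph.fromRel (fun a b =>
    match a, b with
    | .inl i, .inl j => gadgetPair i j
    | .inl i, .inr j => i = j
    | _, _ => False)

/-- The gadget weights: `w_u = w`, `w_{u₁} = w_{u₄} = M - w`, `w_{u₂} = w_{u₃} = k + w`
and `M + k + 1` on each vertex `ũ_i`. -/
noncomputable def gadgetWeight (w k M : ℝ) : Fin 5 ⊕ Fin 5 → ℝ :=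
  Sum.elim ![w, M - w, k + w, k + w, M - w] (fun _ => M + k + 1)

theorem GraphOrientation.wStarVal_le_wStarMax [Nonempty V] {G : SimpleGraph V}
    (Λ : GraphOrientation G) (w : V → ℝ) (v : V) : Λ.wStarVal w v ≤ Λ.wStarMax w :=
  le_sup' (Λ.wStarVal w) (mem_univ v)

theorem GraphOrientation.dir_of_not_dir {V : Type*} {G : SimpleGraph V}
    (Λ : GraphOrientation G) {a b : V} (hab : G.Adj a b) (h : Λ.dir a b ≠ true) :
    Λ.dir b a = true :=
  (Λ.dir_iff b a hab.symm).2 (by simpa using h)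

theorem GraphOrientation.sum_le_wIndeg {G : SimpleGraph V} (Λ : GraphOrientation G)
    {w : V → ℝ} (hw : ∀ a, 0 ≤ w a) {v : V} {s : Finset V} (hs : ∀ a ∈ s, Λ.dir a v = true) :
    ∑ a ∈ s, w a ≤ Λ.wIndeg w v :=
  sum_le_sum_of_subset_of_nonneg (fun a ha => by simpa using hs a ha) fun a _ _ => hw a

theorem GraphOrientation.wIndeg_le_wStarVal {G : SimpleGraph V} (Λ : GraphOrientation G)
    {w : V → ℝ} (hw : ∀ a, 0 ≤ w a) (v : V) : Λ.wIndeg w v ≤ Λ.wStarVal w v := by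
  unfold GraphOrientation.wStarVal
  split_ifs
  · exact le_add_of_nonneg_right (hw v)
  · simp

theorem GraphOrientation.wStarVal_of_dir {G : SimpleGraph V} (Λ : GraphOrientation G)
    (w : V → ℝ) {v a : V} (h : Λ.dir v a = true) :
    Λ.wStarVal w v = Λ.wIndeg w v + w v := by
  have hpos : 0 < Λ.outdeg v := card_pos.2 ⟨a, by simpa using h⟩
  simp [GraphOrientation.wStarVal, hpos]

theorem gadgetWeight_nonneg {w k M : ℝ} (hw : 0 < w) (hk : 0 < k) (hM : k + 2 * w ≤ M)
    (a : Fin 5 ⊕ Fin 5) : 0 ≤ gadgetWeight w k M a := by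
  rcases a with i | i
  · fin_cases i <;> simp [gadgetWeight] <;> linarith
  · simp only [gadgetWeight, Sum.elim_inr]
    linarith

theorem gadgetGraph_adj_pendant (i : Fin 5) : gadgetGraph.Adj (Sum.inl i) (Sum.inr i) := by
  simp [gadgetGraph]

theorem gadgetGraph_adj_of_gadgetPair {i j : Fin 5} (h : gadgetPair i j) (hij : i ≠ j) :
    gadgetGraph.Adj (Sum.inl i) (Sum.inl j) := by
  simp [gadgetGraph, h, hij]

/-- For `w, k > 0` and `M ≥ k + 2w`, every orientation of the gadget
graph with weighted star value at most `M + k` directs the edge `{u,ũ}` toward `ũ` and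
the edge `{u,u₁}` toward `u`. -/
theorem stmt14 (w k M : ℝ) (hw : 0 < w) (hk : 0 < k) (hM : k + 2 * w ≤ M)
    (Λ : GraphOrientation gadgetGraph)
    (hΛ : Λ.wStarMax (gadgetWeight w k M) ≤ M + k) :
    Λ.dir (Sum.inl 0) (Sum.inr 0) = true ∧ Λ.dir (Sum.inl 1) (Sum.inl 0) = true := by
  have hle := fun v => (Λ.wStarVal_le_wStarMax (gadgetWeight w k M) v).trans hΛ
  have hnn := gadgetWeight_nonneg hw hk hM
  have pendant (i : Fin 5) : Λ.dir (Sum.inl i) (Sum.inr i) = true := by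
    refine Λ.dir_of_not_dir (gadgetGraph_adj_pendant i).symm fun h => ?_
    have hin := Λ.sum_le_wIndeg hnn (v := Sum.inl i) (s := {Sum.inr i}) (by simpa using h)
    have hstar := (Λ.wIndeg_le_wStarVal hnn (Sum.inl i)).trans (hle _)
    simp only [sum_singleton, gadgetWeight, Sum.elim_inr] at hin hstar
    linarith
  have load_two {i a b : Fin 5} (hab : a ≠ b) (ha : Λ.dir (Sum.inl a) (Sum.inl i) = true)
      (hb : Λ.dir (Sum.inl b) (Sum.inl i) = true) :
      gadgetWeight w k M (Sum.inl a) + gadgetWeight w k M (Sum.inl b)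
        + gadgetWeight w k M (Sum.inl i) ≤ M + k := by
    have hin := Λ.sum_le_wIndeg hnn (v := Sum.inl i) (s := {Sum.inl a, Sum.inl b})
      (by simp [ha, hb])
    rw [sum_pair (by simpa using hab)] at hin
    have hstar := hle (Sum.inl i)
    rw [Λ.wStarVal_of_dir _ (pendant i)] at hstar
    linarith
  refine ⟨pendant 0, Λ.dir_of_not_dir
    (gadgetGraph_adj_of_gadgetPair (by simp [gadgetPair]) (by decide)) fun h01 => ?_⟩
  have h12 : Λ.dir (Sum.inl 1) (Sum.inl 2) = true := by
    refine Λ.dir_of_not_dir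
      (gadgetGraph_adj_of_gadgetPair (by simp [gadgetPair]) (by decide)).symm fun h => ?_
    have := load_two (by decide) h01 h
    simp [gadgetWeight] at this
    linarith
  have h23 : Λ.dir (Sum.inl 2) (Sum.inl 3) = true := by
    refine Λ.dir_of_not_dir
      (gadgetGraph_adj_of_gadgetPair (by simp [gadgetPair]) (by decide)).symm fun h => ?_
    have := load_two (by decide) h12 h
    simp [gadgetWeight] at this
    linarith
  have h24 : Λ.dir (Sum.inl 2) (Sum.inl 4) = true := by
    refine Λ.dir_of_not_dir
      (gadgetGraph_adj_of_gadgetPair (by simp [gadgetPair]) (by decide)).symm fun h => ?_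
    have := load_two (by decide) h12 h
    simp [gadgetWeight] at this
    linarith
  have h43 : Λ.dir (Sum.inl 4) (Sum.inl 3) = true := by
    refine Λ.dir_of_not_dir
      (gadgetGraph_adj_of_gadgetPair (by simp [gadgetPair]) (by decide)) fun h => ?_
    have := load_two (by decide) h24 h
    simp [gadgetWeight] at this
    linarith
  have := load_two (by decide) h23 h43
  simp [gadgetWeight] at this
  linarith
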